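/- Suppose n = ∞. Then every admissible representation of G over ℚ is homotopy invariant. -/

import Mathlib

universe u

/-- The topology of pointwise convergence on `Aut(F/k)`, where `F` carries the
discrete topology: a base of open neighbourhoods of the identity is given by
the pointwise stabilizers of finite subsets of `F`. -/
def autTop (k F : Type*) [Field k] [Field F] [Algebra k F] :
    TopologicalSpace (F ≃ₐ[k] F) :=
  TopologicalSpace.induced (fun g (x : F) => g x)
    (@Pi.topologicalSpace F (fun _ => F) (fun _ => ⊥))

section Reps

variable {k F : Type*} [Field k] [Field F] [Algebra k F]
variable {W : Type u} [AddCommGroup W] [Module ℚ W]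

/-- The subspace of vectors fixed by a subgroup `U` of `G = Aut(F/k)`. -/
def fixedSubmodule (ρ : Representation ℚ (F ≃ₐ[k] F) W)
    (U : Subgroup (F ≃ₐ[k] F)) : Submodule ℚ W where
  carrier := {w | ∀ g ∈ U, ρ g w = w}
  add_mem' := by
    intro a b ha hb g hg
    rw [map_add, ha g hg, hb g hg]
  zero_mem' := fun g _ => map_zero _
  smul_mem' := by
    intro c w hw g hg
    rw [map_smul, hw g hg]

/-- A representation of `G = Aut(F/k)` is smooth if the stabilizer of every
vector is open. -/
def IsSmoothRep (ρ : Representation ℚ (F ≃ₐ[k] F) W) : Prop :=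
  ∀ w : W, @IsOpen _ (autTop k F) {g : F ≃ₐ[k] F | ρ g w = w}

/-- A representation of `G = Aut(F/k)` is admissible if it is smooth and the
fixed subspace of every open subgroup is finite-dimensional over `ℚ`. -/
def IsAdmissibleRep (ρ : Representation ℚ (F ≃ₐ[k] F) W) : Prop :=
  IsSmoothRep ρ ∧ ∀ U : Subgroup (F ≃ₐ[k] F),
    @IsOpen _ (autTop k F) (U : Set (F ≃ₐ[k] F)) →
      FiniteDimensional ℚ ↥(fixedSubmodule ρ U)

/-- `L'` is a purely transcendental extension of the intermediate field `L`:
`L'` is generated over `L` by a set of algebraically independent elements. -/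
def IsPurelyTranscendentalExt (L L' : IntermediateField k F) : Prop :=
  ∃ s : Set F, AlgebraicIndependent ↥L (Subtype.val : s → F) ∧
    (IntermediateField.adjoin ↥L s).restrictScalars k = L'

/-- A representation of `G = Aut(F/k)` is homotopy invariant if
`W^{G_{F/L}} = W^{G_{F/L'}}` whenever `L'/L` is a purely transcendental
subextension of `F/k`. -/
def IsHomotopyInvariantRep (ρ : Representation ℚ (F ≃ₐ[k] F) W) : Prop :=
  ∀ L L' : IntermediateField k F, IsPurelyTranscendentalExt L L' →
    fixedSubmodule ρ L.fixingSubgroup = fixedSubmodule ρ L'.fixingSubgroup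

end Reps

open Polynomial in
/-- A rational endomorphism whose `2 ^ m`-th power has eigenvalue `-1` acts on a space of dimension
at least `2 ^ m`, since `X ^ 2 ^ m + 1` is irreducible over `ℚ`. -/
theorem two_pow_le_finrank_of_pow_apply_eq_neg {V : Type*} [AddCommGroup V] [Module ℚ V]
    [FiniteDimensional ℚ V] (T : Module.End ℚ V) {e : V} (he : e ≠ 0) {m : ℕ}
    (h : (T ^ 2 ^ m) e = -e) : 2 ^ m ≤ Module.finrank ℚ V := by
  have hc : cyclotomic (2 ^ (m + 1)) ℚ = X ^ 2 ^ m + 1 := by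
    rw [cyclotomic_prime_pow_eq_geom_sum Nat.prime_two]
    simp [Finset.sum_range_succ, add_comm]
  have hirr : Irreducible (X ^ 2 ^ m + 1 : ℚ[X]) :=
    hc ▸ cyclotomic.irreducible_rat (by positivity)
  have hdeg : (X ^ 2 ^ m + 1 : ℚ[X]).degree = (2 ^ m : ℕ) := by
    simpa using degree_X_pow_add_C (R := ℚ) (n := 2 ^ m) (by positivity) 1
  let f : degreeLT ℚ (2 ^ m) →ₗ[ℚ] V :=
    (LinearMap.applyₗ e).comp ((aeval T).toLinearMap.comp (degreeLT ℚ (2 ^ m)).subtype)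
  have hf : Function.Injective f := by
    rw [injective_iff_map_eq_zero]
    rintro ⟨q, hq⟩ hq0
    have hq0 : aeval T q e = 0 := hq0
    by_contra hne
    have hne : q ≠ 0 := fun h0 => hne (Subtype.ext h0)
    have hcop : IsCoprime (X ^ 2 ^ m + 1 : ℚ[X]) q := by
      refine hirr.coprime_iff_not_dvd.2 fun hd => ?_
      exact (degree_le_of_dvd hd hne).not_gt (hdeg ▸ mem_degreeLT.1 hq)
    obtain ⟨a, b, hab⟩ := hcop
    apply he
    have := congrArg (fun r => aeval T r e) hab
    simpa [hq0, h] using this.symm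
  have := LinearMap.finrank_le_finrank_of_injective hf
  rwa [(degreeLTEquiv ℚ (2 ^ m)).finrank_eq, Module.finrank_fin_fun] at this

open MvPolynomial in
/-- An invertible affine substitution in a transcendental element extends to an automorphism of an
algebraically closed overfield. -/
theorem exists_algEquiv_apply_eq_affine {E F : Type*} [Field E] [Field F] [Algebra E F]
    [IsAlgClosed F] {v : F} (hv : Transcendental E v) {c : E} (hc : c ≠ 0) (d : E) :
    ∃ σ : F ≃ₐ[E] F, σ v = algebraMap E F c * v + algebraMap E F d := by
  classical
  obtain ⟨B, hvB, hB⟩ := exists_isTranscendenceBasis_superset (R := E) (s := {v})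
    ((algebraicIndependent_singleton_iff (⟨v, rfl⟩ : ({v} : Set F))).2 hv)
  let b : B := ⟨v, hvB rfl⟩
  let φ : MvPolynomial B E ≃ₐ[E] MvPolynomial B E := AlgEquiv.ofAlgHom
    (aeval (Function.update X b (C c * X b + C d)))
    (aeval (Function.update X b (C c⁻¹ * (X b - C d))))
    (by
      ext1 i
      by_cases h : i = b
      · subst h
        simp [← mul_assoc, ← C_mul, hc, ← algebraMap_eq]
        simp
      · simp [Function.update_of_ne h])
    (by
      ext1 i
      by_cases h : i = b
      · subst h
        simp [← mul_assoc, ← C_mul, hc, ← algebraMap_eq]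
        simp
      · simp [Function.update_of_ne h])
  let e := (hB.1.aevalEquiv.symm.trans φ).trans hB.1.aevalEquiv
  have := IsAlgClosed.isAlgClosure_of_transcendence_basis _ hB
  let σ := IsAlgClosure.equivOfEquiv F F e.toRingEquiv
  have hσ (p : MvPolynomial B E) : σ (aeval (↑) p) = aeval (↑) (φ p) := by
    have := IsAlgClosure.equivOfEquiv_algebraMap F F e.toRingEquiv (hB.1.aevalEquiv p)
    simpa [e, σ] using this
  refine ⟨AlgEquiv.ofRingEquiv (f := σ) fun r => by
    simpa only [AlgEquiv.commutes, AlgHom.commutes] using hσ (algebraMap E _ r), ?_⟩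
  simpa [φ, b] using hσ (X b)

/-- If `F` is algebraic over `M`, then on a finite set every automorphism fixing a suitable finite
part of `M` agrees with one fixing all of `M`. -/
theorem exists_finite_forall_exists_fixingSubgroup {k F : Type*} [Field k] [Field F] [Algebra k F]
    [IsAlgClosed F] [CharZero F] (M : IntermediateField k F) [Algebra.IsAlgebraic M F]
    {T : Set F} (hT : T.Finite) :
    ∃ C : Set F, C.Finite ∧ C ⊆ M ∧ ∀ g : F ≃ₐ[k] F, (∀ c ∈ C, g c = c) →
      ∃ g' ∈ M.fixingSubgroup, ∀ t ∈ T, g' t = g t := by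
  have := hT.to_subtype
  have : FiniteDimensional M (IntermediateField.adjoin M T) :=
    IntermediateField.finiteDimensional_adjoin (S := T) fun x _ => Algebra.IsIntegral.isIntegral x
  obtain ⟨α, hα⟩ := Field.exists_primitive_element M (IntermediateField.adjoin M T)
  have hp (t : F) (ht : t ∈ T) : ∃ p : Polynomial M, Polynomial.aeval (α : F) p = t := by
    have h1 : (⟨t, IntermediateField.subset_adjoin M T ht⟩ : IntermediateField.adjoin M T) ∈
      IntermediateField.adjoin M {α} := hα ▸ IntermediateField.mem_top
    rw [← IntermediateField.mem_toSubalgebra,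
      IntermediateField.adjoin_simple_toSubalgebra_of_isAlgebraic
        (Algebra.IsAlgebraic.isAlgebraic α),
      Algebra.adjoin_singleton_eq_range_aeval] at h1
    obtain ⟨p, hp⟩ := h1
    refine ⟨p, ?_⟩
    have := congrArg Subtype.val hp
    simpa using this
  choose! p hp using hp
  let coeffSet (q : Polynomial M) : Set F := (↑) '' (q.coeffs : Set M)
  have key (q : Polynomial M) (g : F ≃ₐ[k] F) (hg : ∀ c ∈ coeffSet q, g c = c) (a : F) :
      g (Polynomial.aeval a q) = Polynomial.aeval (g a) q := by
    simp only [Polynomial.aeval_eq_sum_range, map_sum]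
    refine Finset.sum_congr rfl fun i _ => ?_
    by_cases h : q.coeff i = 0
    · simp [h]
    · have := hg (q.coeff i) ⟨_, Polynomial.coeff_mem_coeffs h, rfl⟩
      rw [Algebra.smul_def, Algebra.smul_def, map_mul, map_pow]
      exact congrArg (· * _) this
  refine ⟨coeffSet (minpoly M (α : F)) ∪ ⋃ t ∈ T, coeffSet (p t), ?_, ?_, ?_⟩
  · exact ((Finset.finite_toSet _).image _).union
      (hT.biUnion fun t _ => (Finset.finite_toSet _).image _)
  · refine Set.union_subset ?_ (Set.iUnion₂_subset fun t _ => ?_)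
    all_goals rintro _ ⟨c, -, rfl⟩; exact c.2
  · intro g hg
    have hroot : Polynomial.aeval (g α) (minpoly M (α : F)) = 0 := by
      rw [← key _ g (fun c hc => hg c (Or.inl hc)), minpoly.aeval, map_zero]
    have : IsAlgClosure M F := ⟨inferInstance, inferInstance⟩
    have : Normal M F := IsAlgClosure.normal M F
    obtain ⟨σ, hσ⟩ := minpoly.exists_algEquiv_of_root'
      (Algebra.IsAlgebraic.isAlgebraic (α : F)) hroot
    refine ⟨σ.restrictScalars k, ?_, fun t ht => ?_⟩
    · rw [IntermediateField.mem_fixingSubgroup_iff]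
      exact fun x hx => σ.commutes ⟨x, hx⟩
    · rw [← hp t ht, key _ g fun c hc => hg c (Or.inr (Set.mem_biUnion ht hc)), ← hσ]
      exact (Polynomial.aeval_algHom_apply σ.toAlgHom _ _).symm

section Admissible

variable {k F : Type*} [Field k] [Field F] [Algebra k F]
variable {W : Type u} [AddCommGroup W] [Module ℚ W] {ρ : Representation ℚ (F ≃ₐ[k] F) W}

theorem isOpen_fixingSubgroup_of_finite {S : Set F} (hS : S.Finite) :
    @IsOpen _ (autTop k F) (fixingSubgroup (F ≃ₐ[k] F) S : Set (F ≃ₐ[k] F)) := by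
  let : TopologicalSpace F := ⊥
  have : DiscreteTopology F := ⟨rfl⟩
  refine isOpen_induced_iff.2 ⟨S.pi fun x => {x}, isOpen_set_pi hS fun _ _ => isOpen_discrete _, ?_⟩
  ext g
  simp [mem_fixingSubgroup_iff, Set.mem_pi]

/-- In a smooth representation every vector is fixed by the stabilizer of a finite subset of `F`. -/
theorem IsSmoothRep.exists_finite (hρ : IsSmoothRep ρ) (w : W) :
    ∃ T : Set F, T.Finite ∧ ∀ g : F ≃ₐ[k] F, (∀ t ∈ T, g t = t) → ρ g w = w := by
  let : TopologicalSpace F := ⊥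
  obtain ⟨O, hO, hOw⟩ := isOpen_induced_iff.1 (hρ w)
  have h1 : (fun x => (1 : F ≃ₐ[k] F) x) ∈ O := by
    change (1 : F ≃ₐ[k] F) ∈ (fun (g : F ≃ₐ[k] F) (x : F) => g x) ⁻¹' O
    simp [hOw]
  obtain ⟨I, U, hU, hIU⟩ := isOpen_pi_iff.1 hO _ h1
  refine ⟨I, I.finite_toSet, fun g hg => ?_⟩
  have : g ∈ (fun (g : F ≃ₐ[k] F) (x : F) => g x) ⁻¹' O := by
    refine hIU fun t ht => ?_
    simpa [hg t ht] using (hU t ht).2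
  rwa [hOw] at this

theorem apply_eq_apply_of_forall_apply_eq {S : Set F} {w : W}
    (hw : ∀ g : F ≃ₐ[k] F, (∀ a ∈ S, g a = a) → ρ g w = w) {g h : F ≃ₐ[k] F}
    (hgh : ∀ a ∈ S, g a = h a) : ρ g w = ρ h w := by
  have := hw (h⁻¹ * g) fun a ha => by
    rw [AlgEquiv.mul_apply, hgh a ha]
    exact h.symm_apply_apply a
  rw [map_mul, Module.End.mul_apply] at this
  simpa only [Representation.self_inv_apply] using congrArg (ρ h) this

open AlgebraicIndependent (matroid)

/-- The closure in the algebraic independence matroid is the relative algebraic closure. -/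
theorem mem_matroid_closure_iff {S : Set F} {x : F} :
    x ∈ (matroid k F).closure S ↔ IsAlgebraic (IntermediateField.adjoin k S) x := by
  rw [AlgebraicIndependent.matroid_closure_eq, IntermediateField.isAlgebraic_adjoin_iff]
  rfl

theorem exists_apply_eq_affine [IsAlgClosed F] {S : Set F} {u x : F} (hu : u ∈ S)
    (hx : x ∉ (matroid k F).closure S) {ζ : k} (hζ : ζ ≠ 0) :
    ∃ τ : F ≃ₐ[k] F, (∀ a ∈ S, τ a = a) ∧ τ x = u + algebraMap k F ζ * (x - u) := by
  rw [mem_matroid_closure_iff] at hx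
  have huS := IntermediateField.subset_adjoin k S hu
  obtain ⟨σ, hσ⟩ := exists_algEquiv_apply_eq_affine hx
    (c := algebraMap k (IntermediateField.adjoin k S) ζ) (by simpa using hζ)
    (⟨u, huS⟩ - algebraMap k (IntermediateField.adjoin k S) ζ * ⟨u, huS⟩)
  refine ⟨σ.restrictScalars k, fun a ha => ?_, ?_⟩
  · exact σ.commutes ⟨a, IntermediateField.subset_adjoin k S ha⟩
  · refine hσ.trans ?_
    rw [map_sub, map_mul, ← IsScalarTower.algebraMap_apply, IntermediateField.algebraMap_apply]
    ring

/-- The reflection `x ↦ 2u - x` acts trivially on the vectors fixed by `Aut(F/k(S, x))`: it is the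
`2 ^ m`-th power of a homothety centred at `u` for every `m`, so the fixed space would otherwise have
dimension at least `2 ^ m`. -/
theorem IsAdmissibleRep.apply_eq_self_of_reflection [IsAlgClosed k] [IsAlgClosed F]
    (hρ : IsAdmissibleRep ρ) {S : Set F} (hS : S.Finite) {u x : F} (hu : u ∈ S)
    (hx : x ∉ (matroid k F).closure S) {σ : F ≃ₐ[k] F} (hσ : ∀ a ∈ S, σ a = a)
    (hσx : σ x = 2 * u - x) {w : W}
    (hw : ∀ g : F ≃ₐ[k] F, (∀ a ∈ insert x S, g a = a) → ρ g w = w) : ρ σ w = w := by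
  let H := fixingSubgroup (F ≃ₐ[k] F) (insert x S)
  have := hρ.2 H (isOpen_fixingSubgroup_of_finite (hS.insert x))
  have hV {v : W} : v ∈ fixedSubmodule ρ H ↔
      ∀ g : F ≃ₐ[k] F, (∀ a ∈ insert x S, g a = a) → ρ g v = v := by
    simp [fixedSubmodule, H, mem_fixingSubgroup_iff]
  have hpres {τ : F ≃ₐ[k] F} {ζ : k} (hτ : ∀ a ∈ S, τ a = a)
      (hτx : τ x = u + algebraMap k F ζ * (x - u)) :
      ∀ v ∈ fixedSubmodule ρ H, ρ τ v ∈ fixedSubmodule ρ H := by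
    intro v hv
    rw [hV] at hv ⊢
    intro g hg
    rw [← Module.End.mul_apply, ← map_mul]
    refine apply_eq_apply_of_forall_apply_eq hv fun a ha => ?_
    have hgu := hg u (Set.mem_insert_of_mem _ hu)
    rcases ha with rfl | ha
    · simp [hτx, hgu, hg a (Set.mem_insert _ _)]
    · simp [hτ a ha, hg a (Set.mem_insert_of_mem _ ha)]
  have hσx' : σ x = u + algebraMap k F (-1) * (x - u) := by
    rw [hσx]; simp; ring
  by_contra hne
  let e : fixedSubmodule ρ H :=
    ⟨ρ σ w - w, sub_mem (hpres hσ hσx' w (hV.2 hw)) (hV.2 hw)⟩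
  have he : e ≠ 0 := fun h => hne (sub_eq_zero.1 (congrArg Subtype.val h))
  have hσe : ρ σ e = -e := by
    have : ρ σ (ρ σ w) = w := by
      rw [← Module.End.mul_apply, ← map_mul]
      refine hw _ ?_
      rintro a (rfl | ha)
      · simp [hσx, hσ u hu, map_ofNat]
      · simp [hσ a ha]
    simp [e, this]
  let m := Module.finrank ℚ (fixedSubmodule ρ H)
  obtain ⟨ζ, hζ⟩ := IsAlgClosed.exists_pow_nat_eq (-1 : k) (n := 2 ^ m) (by positivity)
  have hζ0 : ζ ≠ 0 := by
    rintro rfl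
    simp at hζ
  obtain ⟨τ, hτ, hτx⟩ := exists_apply_eq_affine hu hx hζ0
  have hτpow (n : ℕ) : (∀ a ∈ S, (τ ^ n) a = a) ∧
      (τ ^ n) x = u + algebraMap k F (ζ ^ n) * (x - u) := by
    induction n with
    | zero => simp
    | succ n ih =>
      refine ⟨fun a ha => by rw [pow_succ, AlgEquiv.mul_apply, hτ a ha, ih.1 a ha], ?_⟩
      rw [pow_succ, AlgEquiv.mul_apply, hτx]
      simp only [map_add, map_mul, map_sub, AlgEquiv.commutes, ih.2, ih.1 u hu, pow_succ]
      ring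
  let T : Module.End ℚ (fixedSubmodule ρ H) := (ρ τ).restrict (hpres hτ hτx)
  have hT : (T ^ 2 ^ m) e = -e := by
    have hTe : ((T ^ 2 ^ m) e : W) = ρ (τ ^ 2 ^ m) e := by
      rw [Module.End.pow_restrict, map_pow]
      rfl
    refine Subtype.ext (hTe.trans (Eq.trans ?_ hσe))
    refine apply_eq_apply_of_forall_apply_eq (hV.1 e.2) ?_
    rintro a (rfl | ha)
    · rw [(hτpow _).2, hζ, hσx']
    · rw [(hτpow _).1 a ha, hσ a ha]
  exact (two_pow_le_finrank_of_pow_apply_eq_neg T he hT).not_gt Nat.lt_two_pow_self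

theorem exists_notMem_matroid_closure (hn : ∃ x : ℕ → F, IsTranscendenceBasis k x) {D : Set F}
    (hD : D.Finite) : ∃ y : F, y ∉ (matroid k F).closure D := by
  obtain ⟨x, hx⟩ := hn
  by_contra! h
  have : Algebra.IsAlgebraic (Algebra.adjoin k D) F := by
    rw [← AlgebraicIndependent.matroid_spanning_iff, Matroid.spanning_iff]
    exact ⟨Set.eq_univ_of_forall h, Set.subset_univ _⟩
  have h1 := Algebra.IsAlgebraic.trdeg_le_cardinalMk (R := k) (A := F) D
  have h2 := hx.lift_cardinalMk_eq_trdeg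
  have h3 : Cardinal.mk D < Cardinal.aleph0 := hD.lt_aleph0
  simp at h2
  rw [← h2] at h1
  exact h1.not_gt h3

theorem add_notMem_matroid_closure {D : Set F} {y d : F} (hy : y ∉ (matroid k F).closure D)
    (hd : d ∈ (matroid k F).closure D) : y + d ∉ (matroid k F).closure D := by
  rw [mem_matroid_closure_iff] at *
  exact fun h => hy (by simpa using h.sub hd)

theorem notMem_matroid_closure_insert {D A : Set F} {x u : F} (hx : x ∉ (matroid k F).closure A)
    (hu : u ∉ (matroid k F).closure D) (hAD : insert x A ⊆ D) :
    x ∉ (matroid k F).closure (insert u A) := fun h =>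
  hu ((matroid k F).closure_subset_closure hAD (Matroid.mem_closure_insert hx h))

/-- Homotopy invariance for adjoining one transcendental element to a finitely generated field. -/
theorem IsAdmissibleRep.apply_eq_self_of_insert [IsAlgClosed k] [IsAlgClosed F] [CharZero F]
    (hρ : IsAdmissibleRep ρ) (hn : ∃ x : ℕ → F, IsTranscendenceBasis k x)
    {A : Set F} (hA : A.Finite) {x : F} (hx : x ∉ (matroid k F).closure A) {w : W}
    (hw : ∀ g : F ≃ₐ[k] F, (∀ a ∈ insert x A, g a = a) → ρ g w = w)
    (g : F ≃ₐ[k] F) (hg : ∀ a ∈ A, g a = a) : ρ g w = w := by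
  let D := insert x (insert (g x) A)
  obtain ⟨u, hu⟩ := exists_notMem_matroid_closure hn (D := D) ((hA.insert _).insert _)
  let u' := u + (g x - x) / 2
  have hmem {a : F} (ha : a ∈ D) : IsAlgebraic (IntermediateField.adjoin k D) a :=
    mem_matroid_closure_iff.1 ((matroid k F).mem_closure_of_mem ha)
  have hu' : u' ∉ (matroid k F).closure D := by
    refine add_notMem_matroid_closure hu (mem_matroid_closure_iff.2 ?_)
    rw [div_eq_mul_inv]
    refine ((hmem (by simp [D])).sub (hmem (by simp [D]))).mul ?_
    have h2 : algebraMap (IntermediateField.adjoin k D) F 2⁻¹ = 2⁻¹ := by rw [map_inv₀, map_ofNat]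
    exact h2 ▸ isAlgebraic_algebraMap _
  have hgx : g x ∉ (matroid k F).closure A := by
    rw [mem_matroid_closure_iff] at hx ⊢
    refine Transcendental.ringHom_of_comp_eq (RingHom.id _) g hx Function.surjective_id
      g.injective (RingHom.ext fun a => ?_)
    exact ((IntermediateField.forall_mem_adjoin_smul_eq_self_iff k g).2 hg a a.2).symm
  have hxu := notMem_matroid_closure_insert hx hu (Set.insert_subset_insert (Set.subset_insert _ _))
  have hgxu := notMem_matroid_closure_insert hgx hu' (Set.subset_insert _ _)
  obtain ⟨σ, hσ, hσx⟩ := exists_apply_eq_affine (Set.mem_insert u A) hxu (ζ := -1) (by simp)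
  obtain ⟨σ', hσ', hσx'⟩ := exists_apply_eq_affine (Set.mem_insert u' A) hgxu (ζ := -1) (by simp)
  replace hσx : σ x = 2 * u - x := by rw [hσx]; simp; ring
  replace hσx' : σ' (g x) = 2 * u' - g x := by rw [hσx']; simp; ring
  have hσw : ρ σ w = w := by
    refine hρ.apply_eq_self_of_reflection (hA.insert u) (Set.mem_insert _ _) hxu hσ hσx ?_
    exact fun h hh => hw h fun a ha => hh a (Set.insert_subset_insert (Set.subset_insert _ _) ha)
  have hwy (h : F ≃ₐ[k] F) (hh : ∀ a ∈ insert (σ x) A, h a = a) : ρ h w = w := by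
    rw [← hσw, ← Module.End.mul_apply, ← map_mul]
    refine apply_eq_apply_of_forall_apply_eq hw ?_
    rintro a (rfl | ha)
    · exact hh _ (Set.mem_insert _ _)
    · rw [AlgEquiv.mul_apply, hσ a (Set.mem_insert_of_mem _ ha), hh a (Set.mem_insert_of_mem _ ha)]
  have hy : σ x = σ' (g x) := by
    rw [hσx, hσx']; simp only [u']; ring
  have hσw' : ρ σ' w = w := by
    refine hρ.apply_eq_self_of_reflection (hA.insert u') (Set.mem_insert _ _) hgxu hσ' hσx' ?_
    refine fun h hh => hwy h ?_
    rintro a (rfl | ha)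
    · simp [hy, hσx', map_ofNat, hh u' (by simp), hh (g x) (by simp)]
    · exact hh a (by simp [ha])
  have h1 : ρ (σ' * g) w = ρ σ w := by
    refine apply_eq_apply_of_forall_apply_eq hw ?_
    rintro a (rfl | ha)
    · exact hy.symm
    · rw [AlgEquiv.mul_apply, hg a ha, hσ' a (Set.mem_insert_of_mem _ ha),
        hσ a (Set.mem_insert_of_mem _ ha)]
  rw [hσw, map_mul, Module.End.mul_apply] at h1
  have h2 := congrArg (ρ σ'⁻¹) (h1.trans hσw'.symm)
  simpa [← Module.End.mul_apply, ← map_mul] using h2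

/-- Homotopy invariance for adjoining finitely many independent elements to a finitely generated
field. -/
theorem IsAdmissibleRep.apply_eq_self_of_union [IsAlgClosed k] [IsAlgClosed F] [CharZero F]
    (hρ : IsAdmissibleRep ρ) (hn : ∃ x : ℕ → F, IsTranscendenceBasis k x)
    (L : IntermediateField k F) {A B : Set F} (hA : A.Finite) (hAL : A ⊆ L) (hB : B.Finite)
    (hBL : AlgebraicIndepOn L id B) {w : W}
    (hw : ∀ g : F ≃ₐ[k] F, (∀ a ∈ A ∪ B, g a = a) → ρ g w = w)
    (g : F ≃ₐ[k] F) (hg : ∀ a ∈ A, g a = a) : ρ g w = w := by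
  induction B, hB using Set.Finite.induction_on with
  | empty => exact hw g (by simpa using hg)
  | @insert b B hb hB ih =>
    obtain ⟨hBL', hbB⟩ := (AlgebraicIndepOn.insert_iff hb).1 hBL
    refine ih hBL' fun h hh => ?_
    refine hρ.apply_eq_self_of_insert hn (hA.union hB) (x := b) ?_ ?_ h hh
    · rw [mem_matroid_closure_iff]
      rw [Set.image_id, ← IntermediateField.transcendental_adjoin_iff] at hbB
      have hle : IntermediateField.adjoin k (A ∪ B) ≤
          (IntermediateField.adjoin L B).restrictScalars k := by
        rw [IntermediateField.restrictScalars_adjoin]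
        exact IntermediateField.adjoin.mono k _ _ (Set.union_subset_union_left _ hAL)
      exact fun halg => hbB (halg.ringHom_of_comp_eq (IntermediateField.inclusion hle)
        (RingHom.id F) (IntermediateField.inclusion_injective hle) rfl)
    · simpa using hw

end Admissible

/-- Suppose `n = ∞`.  Every admissible representation of `G = Aut(F/k)` over `ℚ`
is homotopy invariant. -/
theorem statement7 (k F : Type*) [Field k] [Field F] [Algebra k F]
    [IsAlgClosed k] [IsAlgClosed F] [CharZero k] [CharZero F]
    (hn : ∃ x : ℕ → F, IsTranscendenceBasis k x)
    (W : Type u) [AddCommGroup W] [Module ℚ W]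
    (ρ : Representation ℚ (F ≃ₐ[k] F) W)
    (hadm : IsAdmissibleRep ρ) :
    IsHomotopyInvariantRep ρ := by
  intro L L' hLL'
  obtain ⟨s, hs, rfl⟩ := hLL'
  ext w
  constructor
  · intro hw g hg
    refine hw g ?_
    rw [IntermediateField.mem_fixingSubgroup_iff] at hg ⊢
    exact fun x hx => hg x ((IntermediateField.adjoin L s).algebraMap_mem ⟨x, hx⟩)
  intro hw g hg
  obtain ⟨B, hsB, hB⟩ := exists_isTranscendenceBasis_superset hs
  let M := (IntermediateField.adjoin L B).restrictScalars k
  have : Algebra.IsAlgebraic M F := by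
    have := hB.isAlgebraic_field
    rwa [Subtype.range_coe] at this
  obtain ⟨T, hT, hTw⟩ := hadm.1.exists_finite w
  obtain ⟨C, hC, hCM, hCT⟩ := exists_finite_forall_exists_fixingSubgroup M hT
  have hCw (h : F ≃ₐ[k] F) (hh : ∀ c ∈ C, h c = c) : ρ h w = w := by
    obtain ⟨h', hh', hh'T⟩ := hCT h hh
    rw [← apply_eq_apply_of_forall_apply_eq hTw hh'T]
    refine hw h' ?_
    rw [IntermediateField.mem_fixingSubgroup_iff] at hh' ⊢
    exact fun x hx => hh' x (IntermediateField.adjoin.mono L s B hsB hx)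
  have hD (c : F) (hc : c ∈ C) : ∃ D : Set F, D.Finite ∧ D ⊆ L ∪ B ∧
      c ∈ IntermediateField.adjoin k D := by
    have h1 : c ∈ IntermediateField.adjoin k ((L : Set F) ∪ B) := by
      rw [← IntermediateField.restrictScalars_adjoin]
      exact hCM hc
    obtain ⟨D, hD, hcD⟩ := IntermediateField.exists_finset_of_mem_adjoin h1
    exact ⟨D, D.finite_toSet, hD, hcD⟩
  choose! D hDfin hDsub hcD using hD
  let E := ⋃ c ∈ C, D c
  have hE : E.Finite := hC.biUnion hDfin
  have hEsub : E ⊆ L ∪ B := Set.iUnion₂_subset hDsub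
  rw [IntermediateField.mem_fixingSubgroup_iff] at hg
  refine hadm.apply_eq_self_of_union hn L (hE.inter_of_left L) Set.inter_subset_right
    (hE.inter_of_left B) (AlgebraicIndepOn.mono hB.1 Set.inter_subset_right) (fun h hh => ?_) g
    fun a ha => hg a ha.2
  refine hCw h fun c hc => ?_
  refine (IntermediateField.forall_mem_adjoin_smul_eq_self_iff k h).2 (fun a ha => ?_) c (hcD c hc)
  have haE : a ∈ E := Set.mem_biUnion hc ha
  exact hh a ((hEsub haE).imp (⟨haE, ·⟩) (⟨haE, ·⟩))
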